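/- arXiv:1707.09234 — 5 statements merged into one kernel-verified Lean document; each statement's English description precedes it below -/
import Mathlib

section
/- Let k be an algebraically closed field and let R be a prime affine k-algebra that is finitely generated as a module over its center Z(R). Then every k-algebra homomorphism τ : Z(R) → k is the central character of at least one finite-dimensional irreducible representation of R; that is, there exist an integer n ≥ 1 and a surjective k-algebra homomorphism ρ : R → Mₙ(k) such that ρ(z) = τ(z)·Id for all z ∈ Z(R). -/
/-- `R` is an algebra over its center (the center being taken as a `k`-subalgebra). -/
noncomputable instance centerAlgebra (k R : Type*) [CommSemiring k] [Ring R] [Algebra k R] :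
    Algebra (Subalgebra.center k R) R :=
  inferInstanceAs (Algebra (Subring.center R) R)

/-- The quotient of a ring by a maximal two-sided ideal is simple. -/
theorem TwoSidedIdeal.isSimpleRing_quotient {A : Type*} [Ring A] {I : TwoSidedIdeal A}
    (hI : IsCoatom I) : IsSimpleRing I.ringCon.Quotient := by
  have hnt : Nontrivial I.ringCon.Quotient := by
    rw [RingCon.nontrivial_quotient]
    intro h
    exact hI.1 (TwoSidedIdeal.ringCon_injective h)
  refine IsSimpleRing.of_eq_bot_or_eq_top fun K ↦ ?_
  have hle : I ≤ K.comap I.ringCon.mk' := fun x hx ↦ by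
    rw [← TwoSidedIdeal.ker_ringCon_mk' I, TwoSidedIdeal.mem_ker] at hx
    rw [TwoSidedIdeal.mem_comap, hx]
    exact K.zero_mem
  rcases hle.eq_or_lt with h | h
  · left
    refine le_bot_iff.mp fun y hy ↦ ?_
    obtain ⟨x, rfl⟩ := I.ringCon.mk'_surjective y
    have hx : x ∈ I := by rwa [h, TwoSidedIdeal.mem_comap]
    rw [← TwoSidedIdeal.ker_ringCon_mk' I, TwoSidedIdeal.mem_ker] at hx
    rwa [TwoSidedIdeal.mem_bot]
  · right
    rw [← TwoSidedIdeal.one_mem_iff, ← map_one I.ringCon.mk', ← TwoSidedIdeal.mem_comap, hI.2 _ h]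
    exact TwoSidedIdeal.mem_top A

/-- The lattice of two-sided ideals of a left Noetherian ring satisfies the ascending chain
condition. -/
theorem TwoSidedIdeal.wellFoundedGT (A : Type*) [Ring A] [IsNoetherianRing A] :
    WellFoundedGT (TwoSidedIdeal A) :=
  have hmono : StrictMono (fun I : TwoSidedIdeal A ↦ I.asIdeal) := fun _ _ h ↦ h
  hmono.wellFoundedGT

/-- A nonzero finite-dimensional algebra over an algebraically closed field has a matrix algebra
as a quotient. -/
theorem exists_surjective_algHom_matrix (k A : Type*) [Field k] [IsAlgClosed k] [Ring A]
    [Algebra k A] [FiniteDimensional k A] [Nontrivial A] :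
    ∃ (n : ℕ) (ρ : A →ₐ[k] Matrix (Fin n) (Fin n) k), 1 ≤ n ∧ Function.Surjective ρ := by
  have := IsNoetherianRing.of_finite k A
  have := TwoSidedIdeal.wellFoundedGT A
  obtain ⟨I, hI, -⟩ := (eq_top_or_exists_le_coatom (⊥ : TwoSidedIdeal A)).resolve_left bot_ne_top
  have := TwoSidedIdeal.isSimpleRing_quotient hI
  have hsurj := I.ringCon.mkₐ_surjective (α := k)
  have : FiniteDimensional k I.ringCon.Quotient :=
    Module.Finite.of_surjective (I.ringCon.mkₐ k).toLinearMap hsurj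
  obtain ⟨n, hn, ⟨e⟩⟩ :=
    IsSimpleRing.exists_algEquiv_matrix_of_isAlgClosed k I.ringCon.Quotient
  exact ⟨n, e.toAlgHom.comp (I.ringCon.mkₐ k), Nat.one_le_iff_ne_zero.mpr hn.ne,
    e.surjective.comp hsurj⟩

/-- The left ideal generated by an ideal `I` of the center. -/
def centralExtension {k R : Type*} [Field k] [Ring R] [Algebra k R]
    (I : Ideal (Subalgebra.center k R)) : Ideal R where
  __ := (I • ⊤ : Submodule (Subalgebra.center k R) R).toAddSubmonoid
  smul_mem' r x hx := by
    refine Submodule.smul_induction_on (p := fun x ↦ r • x ∈ I • (⊤ : Submodule _ R)) hx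
      (fun z hz y _ ↦ ?_) fun x y hx hy ↦ ?_
    · rw [smul_eq_mul, mul_smul_comm]
      exact Submodule.smul_mem_smul hz trivial
    · rw [smul_add]
      exact add_mem hx hy

theorem mem_centralExtension {k R : Type*} [Field k] [Ring R] [Algebra k R]
    {I : Ideal (Subalgebra.center k R)} {x : R} :
    x ∈ centralExtension I ↔ x ∈ (I • ⊤ : Submodule (Subalgebra.center k R) R) :=
  Iff.rfl

instance isTwoSided_centralExtension {k R : Type*} [Field k] [Ring R] [Algebra k R]
    (I : Ideal (Subalgebra.center k R)) : (centralExtension I).IsTwoSided where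
  mul_mem_of_left {x} r hx := by
    rw [mem_centralExtension] at hx ⊢
    refine Submodule.smul_induction_on (p := fun x ↦ x * r ∈ I • (⊤ : Submodule _ R)) hx
      (fun z hz y _ ↦ ?_) fun x y hx hy ↦ ?_
    · have h : z • y * r = z • (y * r) := mul_assoc _ _ _
      exact h ▸ Submodule.smul_mem_smul hz trivial
    · rw [add_mul]
      exact add_mem hx hy

/-- If `R` is finite over its center, a proper ideal of the center extends to a proper ideal. -/
theorem centralExtension_ne_top {k R : Type*} [Field k] [Ring R] [Algebra k R]
    [hfin : Module.Finite (Subalgebra.center k R) R] {I : Ideal (Subalgebra.center k R)}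
    (hI : I ≠ ⊤) : centralExtension I ≠ ⊤ := by
  intro h
  have hle : (⊤ : Submodule (Subalgebra.center k R) R) ≤ I • ⊤ := fun x _ ↦
    mem_centralExtension.mp (h ▸ Submodule.mem_top)
  obtain ⟨r, hr, hr0⟩ := Submodule.exists_sub_one_mem_and_smul_eq_zero_of_fg_of_le_smul I ⊤
    hfin.fg_top hle
  have hr0 : r = 0 := Subtype.ext <| by
    have h1 : (r : R) * 1 = 0 := hr0 1 trivial
    simpa using h1
  have h1 : (1 : Subalgebra.center k R) = -(r - 1) :=
    Subtype.ext <| hr0 ▸ (by simp : (1 : R) = -(0 - 1))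
  exact hI ((Ideal.eq_top_iff_one I).mpr (h1 ▸ I.neg_mem hr))

theorem centralExtension_mk_center {k R : Type*} [Field k] [Ring R] [Algebra k R]
    (τ : Subalgebra.center k R →ₐ[k] k) (z : Subalgebra.center k R) :
    Ideal.Quotient.mk (centralExtension (RingHom.ker τ)) (z : R) =
      algebraMap k (R ⧸ centralExtension (RingHom.ker τ)) (τ z) := by
  rw [← Ideal.Quotient.mk_algebraMap, Ideal.Quotient.mk_eq_mk_iff_sub_mem, mem_centralExtension]
  have hz : z - algebraMap k _ (τ z) ∈ RingHom.ker τ := by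
    rw [RingHom.mem_ker, map_sub, AlgHom.commutes, Algebra.algebraMap_self_apply, sub_self]
  have h : (z - algebraMap k _ (τ z) : Subalgebra.center k R) • (1 : R) =
      (z : R) - algebraMap k R (τ z) := mul_one _
  exact h ▸ Submodule.smul_mem_smul hz trivial

theorem finite_quotient_centralExtension {k R : Type*} [Field k] [Ring R] [Algebra k R]
    [hfin : Module.Finite (Subalgebra.center k R) R] (τ : Subalgebra.center k R →ₐ[k] k) :
    Module.Finite k (R ⧸ centralExtension (RingHom.ker τ)) := by
  classical
  obtain ⟨s, hs⟩ := hfin.fg_top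
  set π := Ideal.Quotient.mk (centralExtension (RingHom.ker τ)) with hπ
  refine ⟨⟨s.image π, eq_top_iff.mpr fun y _ ↦ ?_⟩⟩
  obtain ⟨x, rfl⟩ := Ideal.Quotient.mk_surjective y
  have hx : x ∈ Submodule.span (Subalgebra.center k R) (s : Set R) := hs ▸ Submodule.mem_top
  induction hx using Submodule.span_induction with
  | mem x hx => exact Submodule.subset_span (by simpa using ⟨x, hx, rfl⟩)
  | zero => simp
  | add x y _ _ hx hy => exact map_add π x y ▸ add_mem (hx trivial) (hy trivial)
  | smul z x _ hx =>
    have h : π (z • x) = τ z • π x := by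
      rw [Algebra.smul_def (τ z), ← centralExtension_mk_center, ← map_mul]
      rfl
    exact h ▸ Submodule.smul_mem _ _ (hx trivial)

/-- **Surjectivity of the central character map.**
Let `k` be an algebraically closed field and `R` a prime affine `k`-algebra that is finitely
generated as a module over its center `Z(R)`. Then every `k`-algebra homomorphism
`τ : Z(R) → k` is the central character of at least one finite-dimensional irreducible
representation of `R`: there are `n ≥ 1` and a surjective `k`-algebra homomorphism
`ρ : R → Mₙ(k)` with `ρ z = τ z • 1` for every central `z`. -/
theorem central_character_map_surjective
    (k R : Type*) [Field k] [IsAlgClosed k] [Ring R] [Algebra k R]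
    (hprime : ∀ a b : R, (∀ r : R, a * r * b = 0) → a = 0 ∨ b = 0)
    (haffine : Algebra.FiniteType k R)
    (hfin : Module.Finite (Subalgebra.center k R) R)
    (τ : Subalgebra.center k R →ₐ[k] k) :
    ∃ (n : ℕ) (ρ : R →ₐ[k] Matrix (Fin n) (Fin n) k),
      1 ≤ n ∧ Function.Surjective ρ ∧
        ∀ z : Subalgebra.center k R, ρ (z : R) = τ z • (1 : Matrix (Fin n) (Fin n) k) := by
  have hne : RingHom.ker τ ≠ ⊤ := RingHom.ker_ne_top τ
  have : Nontrivial (R ⧸ centralExtension (RingHom.ker τ)) :=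
    Ideal.Quotient.nontrivial_iff.mpr (centralExtension_ne_top hne)
  have := finite_quotient_centralExtension τ
  obtain ⟨n, ρ, hn, hρ⟩ :=
    exists_surjective_algHom_matrix k (R ⧸ centralExtension (RingHom.ker τ))
  refine ⟨n, ρ.comp (Ideal.Quotient.mkₐ k _), hn,
    hρ.comp (Ideal.Quotient.mkₐ_surjective k _), fun z ↦ ?_⟩
  rw [AlgHom.comp_apply, Ideal.Quotient.mkₐ_eq_mk, centralExtension_mk_center, AlgHom.commutes,
    Algebra.algebraMap_eq_smul_one]
end

section
/- Let k be an algebraically closed field and let R be a prime affine k-algebra that is generated as a module over its center Z(R) by a finite set of r elements. Then for every k-algebra homomorphism τ : Z(R) → k, any family of pairwise non-equivalent finite-dimensional irreducible representations of R, each having central character τ, has at most r members; i.e. τ is the central character of at most r equivalence classes of irreducible representations. -/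
/-- Two matrix representations of a `k`-algebra `R` are equivalent if they have the same
dimension and are conjugate by an invertible matrix. -/
def RepEquiv {k R : Type*} [CommSemiring k] [Semiring R] [Algebra k R] {n₁ n₂ : ℕ}
    (ρ₁ : R →ₐ[k] Matrix (Fin n₁) (Fin n₁) k) (ρ₂ : R →ₐ[k] Matrix (Fin n₂) (Fin n₂) k) :
    Prop :=
  ∃ h : n₁ = n₂, ∃ x : (Matrix (Fin n₂) (Fin n₂) k)ˣ,
    ∀ a : R, Matrix.reindex (finCongr h) (finCongr h) (ρ₁ a) = x.val * ρ₂ a * (x⁻¹).val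

/-- Every algebra automorphism of a matrix algebra over a field is inner. -/
theorem Matrix.exists_conj_of_algEquiv {k ι : Type*} [Field k] [Fintype ι] [DecidableEq ι]
    (f : Matrix ι ι k ≃ₐ[k] Matrix ι ι k) :
    ∃ x : (Matrix ι ι k)ˣ, ∀ a, f a = x.val * a * (x⁻¹).val := by
  obtain ⟨g, hg⟩ := Module.End.mulSemiringActionToAlgEquiv_conjAct_surjective (K := k) (V := ι → k)
    ((Matrix.toLinAlgEquiv'.symm.trans f).trans Matrix.toLinAlgEquiv')
  refine ⟨Units.map (LinearMap.toMatrixAlgEquiv' : _ ≃ₐ[k] Matrix ι ι k).toRingHom.toMonoidHom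
    (ConjAct.ofConjAct g), fun a ↦ ?_⟩
  have h := congrArg LinearMap.toMatrixAlgEquiv' (DFunLike.congr_fun hg (Matrix.toLinAlgEquiv' a))
  simp only [MulSemiringAction.toAlgEquiv_apply, ConjAct.units_smul_def, map_mul,
    AlgEquiv.trans_apply, LinearMap.toMatrixAlgEquiv'_toLinAlgEquiv', AlgEquiv.symm_apply_apply] at h
  rw [← h]
  rfl

/-- An irreducible representation whose kernel is contained in that of another nonzero
irreducible representation is equivalent to it. -/
theorem repEquiv_of_ker_le {k R : Type*} [Field k] [Ring R] [Algebra k R] {n₁ n₂ : ℕ}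
    (ρ₁ : R →ₐ[k] Matrix (Fin n₁) (Fin n₁) k) (ρ₂ : R →ₐ[k] Matrix (Fin n₂) (Fin n₂) k)
    (h₁ : Function.Surjective ρ₁) (h₂ : Function.Surjective ρ₂)
    (hn₁ : 1 ≤ n₁) (hn₂ : 1 ≤ n₂) (hker : ∀ a, ρ₁ a = 0 → ρ₂ a = 0) :
    RepEquiv ρ₁ ρ₂ := by
  have : NeZero n₁ := ⟨by lia⟩
  have : NeZero n₂ := ⟨by lia⟩
  let f : Matrix (Fin n₁) (Fin n₁) k →ₐ[k] Matrix (Fin n₂) (Fin n₂) k :=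
    { RingHom.liftOfSurjective ρ₁.toRingHom h₁ ⟨ρ₂.toRingHom, hker⟩ with
      commutes' c := by
        rw [← ρ₁.commutes, ← ρ₂.commutes]
        exact RingHom.liftOfRightInverse_comp_apply _ _ _ _ _ }
  have hf (a : R) : f (ρ₁ a) = ρ₂ a := RingHom.liftOfRightInverse_comp_apply _ _ _ _ _
  let e : Matrix (Fin n₁) (Fin n₁) k ≃ₐ[k] Matrix (Fin n₂) (Fin n₂) k :=
    AlgEquiv.ofBijective f ⟨f.toRingHom.injective, fun b ↦
      let ⟨a, ha⟩ := h₂ b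
      ⟨ρ₁ a, (hf a).trans ha⟩⟩
  obtain rfl : n₁ = n₂ := by
    have := e.toLinearEquiv.finrank_eq
    simpa [Module.finrank_matrix, Nat.mul_self_inj] using this
  obtain ⟨x, hx⟩ := Matrix.exists_conj_of_algEquiv e.symm
  refine ⟨rfl, x, fun a ↦ ?_⟩
  rw [← hx, ← hf a]
  exact (e.symm_apply_apply (ρ₁ a)).symm

/-- Finitely many pairwise inequivalent irreducible representations can be separated from a
given one by a single element. -/
theorem exists_ne_zero_and_forall_eq_zero {k R ι : Type*} [Field k] [Ring R] [Algebra k R]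
    (n : ι → ℕ) (ρ : ∀ i : ι, R →ₐ[k] Matrix (Fin (n i)) (Fin (n i)) k)
    (hdim : ∀ i, 1 ≤ n i) (hsurj : ∀ i, Function.Surjective (ρ i))
    (hne : ∀ i j, i ≠ j → ¬ RepEquiv (ρ i) (ρ j)) (i : ι) (s : Finset ι) (hi : i ∉ s) :
    ∃ a : R, ρ i a ≠ 0 ∧ ∀ j ∈ s, ρ j a = 0 := by
  classical
  have : NeZero (n i) := ⟨by have := hdim i; lia⟩
  induction s using Finset.induction_on with
  | empty => exact ⟨1, by simp, by simp⟩
  | insert j s _ ih =>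
    obtain ⟨hij, his⟩ : i ≠ j ∧ i ∉ s := by simpa using hi
    obtain ⟨a, ha, has⟩ := ih his
    obtain ⟨b, hbj, hbi⟩ : ∃ b, ρ j b = 0 ∧ ρ i b ≠ 0 := by
      by_contra! h
      exact hne j i hij.symm
        (repEquiv_of_ker_le _ _ (hsurj j) (hsurj i) (hdim j) (hdim i) h)
    obtain ⟨p, q, hpq⟩ : ∃ p q, ρ i a p q ≠ 0 := by
      by_contra! h
      exact ha (Matrix.ext h)
    obtain ⟨u, v, huv⟩ : ∃ u v, ρ i b u v ≠ 0 := by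
      by_contra! h
      exact hbi (Matrix.ext h)
    obtain ⟨c, hc⟩ := hsurj i (Matrix.single q u 1)
    refine ⟨a * c * b, fun h ↦ ?_, fun l hl ↦ ?_⟩
    · have := congrFun (congrFun h p) v
      rw [map_mul, map_mul, hc, Matrix.mul_apply, Finset.sum_eq_single u] at this
      · simp_all
      · intro w _ hw
        simp [Matrix.mul_single_apply_of_ne, hw]
      · simp
    · obtain rfl | hl := Finset.mem_insert.mp hl
      · simp [hbj]
      · simp [has l hl]

/-- **At most `r` irreducible representations with a given central character.**
Let `k` be an algebraically closed field and `R` a prime affine `k`-algebra that is generated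
as a module over its center `Z(R)` by `r` elements.  Then for every `k`-algebra homomorphism
`τ : Z(R) → k`, any family of pairwise non-equivalent finite-dimensional irreducible
representations of `R`, each with central character `τ`, has at most `r` members. -/
theorem at_most_r_irreps_with_character
    (k R : Type*) [Field k] [IsAlgClosed k] [Ring R] [Algebra k R]
    (hprime : ∀ a b : R, (∀ r : R, a * r * b = 0) → a = 0 ∨ b = 0)
    (haffine : Algebra.FiniteType k R)
    (r : ℕ)
    (hgen : ∃ s : Finset R, s.card = r ∧
      Submodule.span (Subalgebra.center k R) (s : Set R) = ⊤)
    (τ : Subalgebra.center k R →ₐ[k] k)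
    (ι : Type) [Fintype ι] (n : ι → ℕ)
    (ρ : ∀ i : ι, R →ₐ[k] Matrix (Fin (n i)) (Fin (n i)) k)
    (hdim : ∀ i, 1 ≤ n i)
    (hsurj : ∀ i, Function.Surjective (ρ i))
    (hchar : ∀ i, ∀ z : Subalgebra.center k R,
      ρ i (z : R) = τ z • (1 : Matrix (Fin (n i)) (Fin (n i)) k))
    (hne : ∀ i j, i ≠ j → ¬ RepEquiv (ρ i) (ρ j)) :
    Fintype.card ι ≤ r := by
  classical
  obtain ⟨s, rfl, hs⟩ := hgen
  choose e he using fun i ↦ exists_ne_zero_and_forall_eq_zero n ρ hdim hsurj hne i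
    (Finset.univ.erase i) (by simp)
  let Φ : R →ₗ[k] ∀ i, Matrix (Fin (n i)) (Fin (n i)) k := LinearMap.pi fun i ↦ (ρ i).toLinearMap
  let W : Submodule k (∀ i, Matrix (Fin (n i)) (Fin (n i)) k) :=
    Submodule.span k (s.image Φ : Finset _)
  have hW (a : R) : Φ a ∈ W := by
    have ha : a ∈ Submodule.span (Subalgebra.center k R) (s : Set R) := hs ▸ Submodule.mem_top
    induction ha using Submodule.span_induction with
    | mem x hx => exact Submodule.subset_span (by simpa using ⟨x, hx, rfl⟩)
    | zero => simp
    | add x y _ _ hx hy => simpa using W.add_mem hx hy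
    | smul z x _ hx =>
      have : Φ (z • x) = τ z • Φ x := by
        ext1 i
        change ρ i ((z : R) * x) = τ z • ρ i x
        rw [map_mul, hchar, smul_mul_assoc, one_mul]
      exact this ▸ W.smul_mem _ hx
  have hli : LinearIndependent k fun i ↦ (⟨Φ (e i), hW _⟩ : W) := by
    rw [Fintype.linearIndependent_iff]
    intro c hc i
    have h : ∑ j, c j • ρ i (e j) = 0 := by
      simpa [Φ] using congrFun (congrArg Subtype.val hc) i
    rw [Finset.sum_eq_single i (fun j _ hj ↦ by rw [(he j).2 i (by simpa using hj.symm), smul_zero])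
      (by simp)] at h
    exact (smul_eq_zero.mp h).resolve_right (he i).1
  exact hli.fintype_card_le_finrank.trans
    ((finrank_span_finset_le_card _).trans Finset.card_image_le)
end

section
/- Let k be an algebraically closed field and let R be a prime affine k-algebra that is finitely generated as a module over its center Z(R). Then every finite-dimensional irreducible representation ρ : R → M_d(k) satisfies d² ≤ dim_Q(Q ⊗_{Z(R)} R), where Q is the field of fractions of the integral domain Z(R); equivalently, every irreducible representation has dimension at most the square root of the rank of R over Z(R). -/
open TensorProduct

/-- If a torsion-free algebra `R` over a domain `Z` surjects onto `d × d` matrices, lifts of the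
matrix units are linearly independent over `Z`, since a Capelli polynomial does not vanish on
them. -/
theorem linearIndependent_of_map_eq_single {Z R K : Type*} [CommRing Z] [IsDomain Z] [Ring R]
    [Algebra Z R] [Module.IsTorsionFree Z R] [Field K] {d n : ℕ} (i₀ : Fin d)
    (e : Fin n ≃ Fin d × Fin d) (ρ : R →+* Matrix (Fin d) (Fin d) K)
    (hsurj : Function.Surjective ρ) (x : Fin n → R)
    (hx : ∀ t, ρ (x t) = Matrix.single (e t).1 (e t).2 1) : LinearIndependent Z x := by
  classical
  choose s hs using hsurj
  let L : Fin n → R →ₗ[Z] R := fun t =>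
    LinearMap.mulLeft Z (s (Matrix.single i₀ (e t).1 1)) ∘ₗ
      LinearMap.mulRight Z (s (Matrix.single (e t).2 i₀ 1))
  let f := (MultilinearMap.mkPiAlgebraFin Z n R).compLinearMap L
  by_contra hdep
  have hzero : ρ (MultilinearMap.alternatization f x) = 0 := by
    rw [AlternatingMap.map_linearDependent _ _ hdep, map_zero]
  have hL (t u : Fin n) :
      ρ (L t (x u)) = if u = t then Matrix.single i₀ i₀ 1 else 0 := by
    simp only [L, LinearMap.comp_apply, LinearMap.mulLeft_apply, LinearMap.mulRight_apply,
      map_mul, hs, hx]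
    split_ifs with h
    · subst h
      simp
    · rw [← e.injective.eq_iff, Prod.ext_iff, not_and_or] at h
      rcases h with h | h
      · rw [← mul_assoc, Matrix.single_mul_single_of_ne _ _ _ _ (Ne.symm h), zero_mul]
      · rw [Matrix.single_mul_single_of_ne _ _ _ _ h, mul_zero]
  have hprod (σ : Equiv.Perm (Fin n)) :
      ρ (f (fun t => x (σ t))) = if σ = 1 then Matrix.single i₀ i₀ 1 else 0 := by
    simp only [f, MultilinearMap.compLinearMap_apply, MultilinearMap.mkPiAlgebraFin_apply,
      map_list_prod, List.map_ofFn, Function.comp_def, hL]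
    split_ifs with h
    · subst h
      have hn : n ≠ 0 := by
        rintro rfl
        exact (e.symm (i₀, i₀)).elim0
      have hidem : IsIdempotentElem (Matrix.single i₀ i₀ (1 : K)) := by
        simp [IsIdempotentElem]
      simp [List.ofFn_const, hidem.pow_eq hn]
    · obtain ⟨t, ht⟩ : ∃ t, σ t ≠ t := by
        by_contra! h'
        exact h (Equiv.ext h')
      exact List.prod_eq_zero (List.mem_ofFn.2 ⟨t, if_neg ht⟩)
  rw [MultilinearMap.alternatization_apply, map_sum] at hzero
  simp only [Units.smul_def, map_zsmul, MultilinearMap.domDomCongr_apply, hprod] at hzero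
  simpa using congrFun₂ hzero i₀ i₀

/-- A torsion-free algebra over a domain that surjects onto `d × d` matrices over a field has
rank at least `d ^ 2`. -/
theorem sq_le_rank_of_surjective {Z R K : Type*} [CommRing Z] [IsDomain Z] [Ring R]
    [Algebra Z R] [Module.IsTorsionFree Z R] [Field K] {d : ℕ}
    (ρ : R →+* Matrix (Fin d) (Fin d) K) (hsurj : Function.Surjective ρ) :
    ((d ^ 2 : ℕ) : Cardinal) ≤ Module.rank Z R := by
  rcases Nat.eq_zero_or_pos d with rfl | hd
  · simp
  choose s hs using hsurj
  have hli := linearIndependent_of_map_eq_single (Z := Z) ⟨0, hd⟩ finProdFinEquiv.symm ρ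
    (fun y => ⟨s y, hs y⟩) _ fun t => hs (Matrix.single _ _ 1)
  simpa [sq] using hli.cardinal_lift_le_rank

set_option synthInstance.maxHeartbeats 1000000 in
/-- **Dimension bound for irreducible representations.**
Let `k` be an algebraically closed field and `R` a prime affine `k`-algebra that is finitely
generated as a module over its center `Z(R)`.  Then every finite-dimensional irreducible
representation `ρ : R → M_d(k)` satisfies `d² ≤ dim_Q (Q ⊗_{Z(R)} R)`, where `Q` is the field
of fractions of `Z(R)`. -/
theorem irrep_dim_le_sqrt_rank
    (k R : Type*) [Field k] [IsAlgClosed k] [Ring R] [Algebra k R]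
    (hprime : ∀ a b : R, (∀ r : R, a * r * b = 0) → a = 0 ∨ b = 0)
    (haffine : Algebra.FiniteType k R)
    (hfin : Module.Finite (Subalgebra.center k R) R)
    (d : ℕ) (hd : 1 ≤ d)
    (ρ : R →ₐ[k] Matrix (Fin d) (Fin d) k) (hsurj : Function.Surjective ρ) :
    ((d ^ 2 : ℕ) : Cardinal) ≤
      Module.rank (FractionRing (Subalgebra.center k R))
        (FractionRing (Subalgebra.center k R) ⊗[Subalgebra.center k R] R) := by
  have : NeZero d := ⟨by omega⟩
  have : Nontrivial R := ρ.toRingHom.domain_nontrivial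
  have hsmul (z : Subalgebra.center k R) (r : R) (h : z • r = 0) : z = 0 ∨ r = 0 := by
    have hz : (z : R) * r = 0 := h
    refine (hprime z r fun s => ?_).imp_left Subtype.ext
    rw [← (Subalgebra.mem_center_iff.1 z.2 s), mul_assoc, hz, mul_zero]
  have : NoZeroDivisors (Subalgebra.center k R) :=
    ⟨fun {a b} h => (hsmul a b (congrArg Subtype.val h)).imp_right Subtype.ext⟩
  have : IsDomain (Subalgebra.center k R) := NoZeroDivisors.to_isDomain _
  have : Module.IsTorsionFree (Subalgebra.center k R) R :=
    .of_smul_eq_zero hsmul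
  let Z := Subalgebra.center k R
  rw [IsLocalization.rank_eq (FractionRing Z) (nonZeroDivisors Z) le_rfl,
    IsLocalizedModule.rank_eq (nonZeroDivisors Z) le_rfl
      (TensorProduct.mk Z (FractionRing Z) R 1)]
  exact sq_le_rank_of_surjective (Z := Z) ρ.toRingHom hsurj
end

section
/- Let k be an algebraically closed field and let R be a prime affine k-algebra that is finitely generated as a module over its center Z(R). Then the rank of R over Z(R) is a perfect square: there exists a natural number N such that dim_Q(Q ⊗_{Z(R)} R) = N², where Q is the field of fractions of the integral domain Z(R). -/
open TensorProduct

/-- A nontrivial Artinian prime ring is simple. -/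
theorem IsArtinianRing.isSimpleRing_of_prime {A : Type*} [Ring A] [Nontrivial A] [IsArtinianRing A]
    (hA : ∀ a b : A, (∀ r : A, a * r * b = 0) → a = 0 ∨ b = 0) : IsSimpleRing A := by
  have mul_eq_bot : ∀ I J : Ideal A, I.IsTwoSided → I * J = ⊥ → I = ⊥ ∨ J = ⊥ := by
    intro I J hI h
    by_contra! hc
    obtain ⟨x, hx, hx0⟩ := Submodule.exists_mem_ne_zero_of_ne_bot hc.1
    obtain ⟨y, hy, hy0⟩ := Submodule.exists_mem_ne_zero_of_ne_bot hc.2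
    refine (hA x y fun r ↦ ?_).elim hx0 hy0
    exact (Submodule.mem_bot A).mp (h ▸ Ideal.mul_mem_mul (I.mul_mem_right r hx) hy)
  have hss : IsSemisimpleRing A := by
    rw [IsArtinianRing.isSemisimpleRing_iff_jacobson]
    obtain ⟨n, hn⟩ := IsSemiprimaryRing.isNilpotent (R := A)
    induction n with
    | zero =>
      rw [Submodule.pow_zero, Ideal.one_eq_top] at hn
      exact absurd hn top_ne_bot
    | succ n ih =>
      rw [Ideal.IsTwoSided.pow_succ] at hn
      exact (mul_eq_bot _ _ inferInstance hn).elim id ih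
  refine isSimpleRing_iff_isTwoSided_imp.mpr ⟨inferInstance, fun I hI ↦ ?_⟩
  obtain ⟨J, hJ⟩ := exists_isCompl I
  refine (mul_eq_bot I J hI ?_).imp_right fun h ↦ ?_
  · exact le_bot_iff.mp (hJ.disjoint.le_bot.trans' (le_inf Ideal.mul_le_left Ideal.mul_le_right))
  · simpa [h] using hJ.sup_eq_top

/-- A finite-dimensional central simple algebra is Azumaya: every linear endomorphism
is a sum of two-sided multiplications. -/
theorem AlgHom.mulLeftRight_surjective_of_isSimpleRing (K A : Type*) [Field K] [Ring A]
    [Algebra K A] [FiniteDimensional K A] [IsSimpleRing A] [Algebra.IsCentral K A] :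
    Function.Surjective (AlgHom.mulLeftRight K A) := by
  let _ : Module (A ⊗[K] Aᵐᵒᵖ) A := instModuleTensorProductMop K A
  have smul_def : ∀ (t : A ⊗[K] Aᵐᵒᵖ) (a : A), t • a = AlgHom.mulLeftRight K A t a :=
    fun _ _ ↦ rfl
  have : IsSimpleModule (A ⊗[K] Aᵐᵒᵖ) A := by
    refine (isSimpleModule_iff _ _).mpr ⟨fun N ↦ ?_⟩
    let I : Ideal A :=
      { N.toAddSubmonoid with
        smul_mem' := fun a x hx ↦ by
          simpa [smul_def] using N.smul_mem (a ⊗ₜ[K] (1 : Aᵐᵒᵖ)) hx }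
    have hI : I.IsTwoSided := ⟨fun {x} a hx ↦ by
      change x * a ∈ N
      simpa [smul_def] using N.smul_mem ((1 : A) ⊗ₜ[K] MulOpposite.op a) hx⟩
    refine ((isSimpleRing_iff_isTwoSided_imp.mp inferInstance).2 I hI).imp ?_ ?_ <;>
    exact fun h ↦ SetLike.coe_injective (congrArg (SetLike.coe : Ideal A → Set A) h)
  have scalar : ∀ g : Module.End (A ⊗[K] Aᵐᵒᵖ) A, ∃ c : K, ∀ a, g a = c • a := by
    intro g
    have left : ∀ a x, g (a * x) = a * g x := fun a x ↦ by
      simpa [smul_def] using map_smul g (a ⊗ₜ[K] (1 : Aᵐᵒᵖ)) x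
    have right : ∀ a x, g (x * a) = g x * a := fun a x ↦ by
      simpa [smul_def] using map_smul g ((1 : A) ⊗ₜ[K] MulOpposite.op a) x
    have hc : g 1 ∈ Subalgebra.center K A := Subalgebra.mem_center_iff.mpr fun b ↦ by
      rw [← left, ← right, mul_one, one_mul]
    obtain ⟨c, hc⟩ := Algebra.mem_bot.mp (Algebra.IsCentral.out hc)
    exact ⟨c, fun a ↦ by rw [← one_mul a, right, ← hc, Algebra.smul_def, one_mul]⟩
  intro φ
  classical
  let f : Module.End (Module.End (A ⊗[K] Aᵐᵒᵖ) A) A :=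
    { φ.toAddMonoidHom with
      map_smul' := fun g a ↦ by
        obtain ⟨c, hc⟩ := scalar g
        simp [hc] }
  let b := Module.finBasis K A
  obtain ⟨t, ht⟩ := jacobson_density f (Finset.univ.image b)
  refine ⟨t, b.ext fun i ↦ ?_⟩
  exact (ht (b i) (by simp)).symm

/-- Extending the scalars of a finite-dimensional central simple algebra to a larger field
preserves simplicity. -/
theorem IsSimpleRing.baseChange (K L A : Type*) [Field K] [Field L] [Algebra K L] [Ring A]
    [Algebra K A] [FiniteDimensional K A] [IsSimpleRing A] [Algebra.IsCentral K A] :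
    IsSimpleRing (L ⊗[K] A) := by
  refine isSimpleRing_iff_isTwoSided_imp.mpr ⟨inferInstance, fun I hI ↦ ?_⟩
  refine or_iff_not_imp_left.mpr fun hbot ↦ ?_
  obtain ⟨w, hw, hw0⟩ := Submodule.exists_mem_ne_zero_of_ne_bot hbot
  have stable : ∀ t : A ⊗[K] Aᵐᵒᵖ, (AlgHom.mulLeftRight K A t).lTensor L w ∈ I := by
    intro t
    induction t with
    | zero => simp
    | add s t hs ht => simpa [LinearMap.lTensor_add] using I.add_mem hs ht
    | tmul x y =>
      have : (AlgHom.mulLeftRight K A (x ⊗ₜ y)).lTensor L w =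
          ((1 : L) ⊗ₜ[K] x) * w * ((1 : L) ⊗ₜ[K] y.unop) := by
        clear hw hw0
        induction w with
        | zero => simp
        | add u v hu hv => rw [map_add, hu, hv, mul_add, add_mul]
        | tmul l a => simp
      rw [this]
      exact I.mul_mem_right _ (I.mul_mem_left _ hw)
  let b := Module.finBasis K A
  obtain ⟨i, hi⟩ : ∃ i, (b.baseChange L).repr w i ≠ 0 := by
    by_contra! h
    exact hw0 ((b.baseChange L).repr.map_eq_zero_iff.mp (Finsupp.ext h))
  obtain ⟨t, ht⟩ := AlgHom.mulLeftRight_surjective_of_isSimpleRing K A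
    ((b.coord i).smulRight (1 : A))
  have key : ((b.coord i).smulRight (1 : A)).lTensor L w =
      algebraMap L (L ⊗[K] A) ((b.baseChange L).repr w i) := by
    clear hw hw0 stable hi
    induction w with
    | zero => simp
    | add u v hu hv => simp [hu, hv, TensorProduct.add_tmul]
    | tmul l a => simp [Module.Basis.baseChange_repr_tmul, TensorProduct.smul_tmul']
  have hmem := stable t
  rw [ht, key] at hmem
  exact I.eq_top_of_isUnit_mem hmem ((isUnit_iff_ne_zero.mpr hi).map _)

/-- The dimension of a central simple algebra is a perfect square. -/
theorem Algebra.IsCentral.exists_finrank_eq_sq (K A : Type*) [Field K] [Ring A]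
    [Algebra K A] [FiniteDimensional K A] [IsSimpleRing A] [Algebra.IsCentral K A] :
    ∃ n : ℕ, Module.finrank K A = n ^ 2 := by
  have := IsSimpleRing.baseChange K (AlgebraicClosure K) A
  obtain ⟨n, -, ⟨e⟩⟩ := IsSimpleRing.exists_algEquiv_matrix_of_isAlgClosed
    (AlgebraicClosure K) (AlgebraicClosure K ⊗[K] A)
  refine ⟨n, ?_⟩
  rw [← Module.finrank_baseChange (R := AlgebraicClosure K), e.toLinearEquiv.finrank_eq]
  simp [Module.finrank_matrix, sq]

/-- Let `R` be a prime ring that is a finite algebra over `Z`, where `Z` maps isomorphically onto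
the center of `R`. The generic rank of `R` over `Z` is a perfect square. -/
theorem exists_finrank_fractionRing_tensor_eq_sq (Z K R : Type*) [CommRing Z] [IsDomain Z]
    [Field K] [Algebra Z K] [IsFractionRing Z K] [Ring R] [Nontrivial R] [Algebra Z R]
    [Module.Finite Z R]
    (hprime : ∀ a b : R, (∀ r : R, a * r * b = 0) → a = 0 ∨ b = 0)
    (hinj : Function.Injective (algebraMap Z R))
    (hcenter : ∀ r : R, (∀ x : R, x * r = r * x) → ∃ z : Z, algebraMap Z R z = r) :
    ∃ n : ℕ, Module.rank K (K ⊗[Z] R) = ((n ^ 2 : ℕ) : Cardinal) := by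
  let f : R →ₐ[Z] K ⊗[Z] R := Algebra.TensorProduct.includeRight
  have hloc : IsLocalizedModule (nonZeroDivisors Z) (TensorProduct.mk Z K R 1) := inferInstance
  have hf : Function.Injective f := by
    rw [injective_iff_map_eq_zero]
    intro r hr
    obtain ⟨s, hs⟩ := (IsLocalizedModule.eq_zero_iff (nonZeroDivisors Z)
      (TensorProduct.mk Z K R 1)).mp hr
    refine (hprime (algebraMap Z R s) r fun x ↦ ?_).resolve_left ?_
    · rw [Algebra.commutes, mul_assoc, ← Algebra.smul_def]
      exact mul_eq_zero_of_right x hs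
    · rw [map_eq_zero_iff _ hinj]
      exact nonZeroDivisors.ne_zero s.2
  have surj : ∀ a : K ⊗[Z] R, ∃ (c : K) (r : R), c ≠ 0 ∧ c • a = f r := by
    intro a
    obtain ⟨⟨r, s⟩, hr⟩ := IsLocalizedModule.surj (nonZeroDivisors Z) (TensorProduct.mk Z K R 1) a
    refine ⟨algebraMap Z K s, r, ?_, ?_⟩
    · simp
    · rw [algebraMap_smul]
      exact hr
  have : Nontrivial (K ⊗[Z] R) := hf.nontrivial
  have : IsArtinianRing (K ⊗[Z] R) := IsArtinianRing.of_finite K _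
  have : IsSimpleRing (K ⊗[Z] R) := by
    refine IsArtinianRing.isSimpleRing_of_prime fun a b hab ↦ ?_
    obtain ⟨c, r, hc, hr⟩ := surj a
    obtain ⟨d, s, hd, hs⟩ := surj b
    have : r = 0 ∨ s = 0 := hprime r s fun x ↦ hf <| by
      rw [map_mul, map_mul, ← hr, ← hs, smul_mul_assoc, smul_mul_smul_comm, hab, smul_zero,
        map_zero]
    refine this.imp (fun h ↦ ?_) (fun h ↦ ?_)
    · rw [h, map_zero] at hr
      exact (smul_eq_zero.mp hr).resolve_left hc
    · rw [h, map_zero] at hs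
      exact (smul_eq_zero.mp hs).resolve_left hd
  have : Algebra.IsCentral K (K ⊗[Z] R) := by
    refine ⟨fun a ha ↦ ?_⟩
    obtain ⟨c, r, hc, hr⟩ := surj a
    obtain ⟨z, rfl⟩ := hcenter r fun x ↦ hf <| by
      rw [map_mul, map_mul, ← hr]
      exact Subalgebra.mem_center_iff.mp (Subalgebra.smul_mem _ ha c) _
    refine Algebra.mem_bot.mpr ⟨c⁻¹ * algebraMap Z K z, ?_⟩
    rw [AlgHom.commutes, IsScalarTower.algebraMap_apply Z K] at hr
    rw [map_mul, ← hr, ← Algebra.smul_def, inv_smul_smul₀ hc]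
  obtain ⟨n, hn⟩ := Algebra.IsCentral.exists_finrank_eq_sq K (K ⊗[Z] R)
  exact ⟨n, by rw [← hn, Module.finrank_eq_rank]⟩

set_option synthInstance.maxHeartbeats 1000000 in
/-- **The rank of `R` over its center is a perfect square.**
Let `k` be an algebraically closed field and `R` a prime affine `k`-algebra that is finitely
generated as a module over its center `Z(R)`.  Then the rank of `R` over `Z(R)`, i.e. the
dimension of `Q ⊗_{Z(R)} R` over the fraction field `Q` of `Z(R)`, is a perfect square. -/
theorem rank_over_center_is_perfect_square
    (k R : Type*) [Field k] [IsAlgClosed k] [Ring R] [Algebra k R]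
    (hprime : ∀ a b : R, (∀ r : R, a * r * b = 0) → a = 0 ∨ b = 0)
    (haffine : Algebra.FiniteType k R)
    (hfin : Module.Finite (Subalgebra.center k R) R) :
    ∃ N : ℕ,
      Module.rank (FractionRing (Subalgebra.center k R))
        (FractionRing (Subalgebra.center k R) ⊗[Subalgebra.center k R] R)
        = ((N ^ 2 : ℕ) : Cardinal) := by
  rcases subsingleton_or_nontrivial R with hR | hR
  · have : Subsingleton (FractionRing (Subalgebra.center k R)) :=
      (algebraMap (Subalgebra.center k R) _).codomain_trivial
    exact ⟨1, by rw [rank_subsingleton]; simp⟩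
  have : IsDomain (Subalgebra.center k R) := by
    have : NoZeroDivisors (Subalgebra.center k R) := ⟨fun {a b} hab ↦ by
      refine (hprime a b fun r ↦ ?_).imp Subtype.ext Subtype.ext
      rw [mul_assoc, Subalgebra.mem_center_iff.mp b.2 r, ← mul_assoc]
      exact mul_eq_zero_of_left (congrArg Subtype.val hab) r⟩
    exact NoZeroDivisors.to_isDomain _
  exact exists_finrank_fractionRing_tensor_eq_sq (Subalgebra.center k R)
    (FractionRing (Subalgebra.center k R)) R hprime Subtype.val_injective
    fun r hr ↦ ⟨⟨r, Subalgebra.mem_center_iff.mpr hr⟩, rfl⟩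
end

section
/- Let k be an algebraically closed field and let R be a k-algebra whose center Z(R) is an affine k-algebra. Assume that R is an Azumaya algebra over Z(R), and that there is an integer n ≥ 1 such that for every maximal ideal m of Z(R) the quotient ring R/mR has dimension n² as a k-vector space. Then every finite-dimensional irreducible representation of R has dimension exactly n, i.e. every surjective k-algebra homomorphism ρ : R → M_d(k) satisfies d = n. -/
/-- The natural map `A ⊗_C Aᵒᵖ → End_C A`, `α ⊗ β ↦ (γ ↦ α γ β)`.  An algebra `A` which is a
faithful finitely generated projective `C`-module is Azumaya over `C` iff this map is
bijective. -/
noncomputable def azumayaMulLeftRight (C A : Type*) [CommSemiring C] [Semiring A]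
    [Algebra C A] : TensorProduct C A Aᵐᵒᵖ →ₗ[C] Module.End C A :=
  TensorProduct.lift <| LinearMap.mk₂ C
    (fun a b => LinearMap.mulLeft C a ∘ₗ LinearMap.mulRight C b.unop)
    (fun a a' b => by ext c; simp [add_mul])
    (fun s a b => by ext c; simp [smul_mul_assoc])
    (fun a b b' => by ext c; simp [mul_add])
    (fun s a b => by ext c; simp [mul_smul_comm])

/-- A ring homomorphism that kills `x` kills the image of `x` under every endomorphism in the
image of `A ⊗_C Aᵒᵖ`. -/
theorem map_azumayaMulLeftRight_eq_zero {C A B : Type*} [CommSemiring C] [Semiring A]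
    [Algebra C A] [Semiring B] (f : A →+* B) (t : TensorProduct C A Aᵐᵒᵖ) {x : A}
    (hx : f x = 0) : f (azumayaMulLeftRight C A t x) = 0 := by
  induction t using TensorProduct.induction_on with
  | zero => simp
  | tmul a b => simp [azumayaMulLeftRight, hx]
  | add s t hs ht => simp [hs, ht]

/-- If `A` is projective over `C` and `A ⊗_C Aᵒᵖ → End_C A` is surjective, then the kernel of
every ring homomorphism out of `A` is generated by its contraction to `C`. -/
theorem ker_eq_map_comap_of_azumayaMulLeftRight_surjective {C A B : Type*} [CommRing C]
    [Ring A] [Algebra C A] [Module.Projective C A] [Ring B]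
    (h : Function.Surjective (azumayaMulLeftRight C A)) (f : A →+* B) :
    RingHom.ker f =
      Ideal.map (algebraMap C A) (RingHom.ker (f.comp (algebraMap C A))) := by
  apply le_antisymm
  · intro x hx
    obtain ⟨s, hs⟩ := Module.projective_def'.mp ‹Module.Projective C A›
    have hsx : Finsupp.linearCombination C id (s x) = x := LinearMap.congr_fun hs x
    rw [← hsx, Finsupp.linearCombination_apply]
    refine Ideal.sum_mem _ fun a _ => ?_
    change s x a • a ∈ _
    rw [Algebra.smul_def, Algebra.commutes]
    refine Ideal.mul_mem_left _ _ (Ideal.mem_map_of_mem _ ?_)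
    obtain ⟨t, ht⟩ := h (Algebra.linearMap C A ∘ₗ Finsupp.lapply a ∘ₗ s)
    have := map_azumayaMulLeftRight_eq_zero f t hx
    rw [ht] at this
    exact this
  · rw [Ideal.map_le_iff_le_comap]
    exact fun _ hx => hx

/-- The central character of a surjective algebra homomorphism onto a nontrivial central
algebra over a field has a maximal ideal as its kernel. -/
theorem ker_comp_center_isMaximal {k R B : Type*} [Field k] [Ring R] [Algebra k R] [Ring B]
    [Nontrivial B] [Algebra k B] [Algebra.IsCentral k B] (f : R →ₐ[k] B)
    (hf : Function.Surjective f) :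
    (RingHom.ker ((f : R →+* B).comp (algebraMap (Subalgebra.center k R) R))).IsMaximal := by
  rw [Ideal.isMaximal_iff]
  refine ⟨by simp [RingHom.mem_ker], fun J x hJ hx hxJ => ?_⟩
  obtain ⟨c, hc⟩ : ∃ c : k, algebraMap k B c = f x := by
    have : f x ∈ Subalgebra.center k B := by
      rw [Subalgebra.mem_center_iff]
      intro b
      obtain ⟨r, rfl⟩ := hf b
      rw [← map_mul, ← map_mul, Subalgebra.mem_center_iff.mp x.2 r]
    rw [Algebra.IsCentral.center_eq_bot] at this
    exact Algebra.mem_bot.mp this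
  have hc0 : c ≠ 0 := by
    rintro rfl
    exact hx (hc.symm.trans (map_zero _))
  have hmem : c⁻¹ • x - 1 ∈ J := by
    apply hJ
    change f (c⁻¹ • (x : R) - 1) = 0
    rw [map_sub, map_smul, ← hc, map_one, Algebra.algebraMap_eq_smul_one,
      inv_smul_smul₀ hc0, sub_self]
  have hsmul : c⁻¹ • x ∈ J := Submodule.smul_of_tower_mem J c⁻¹ hxJ
  simpa using J.sub_mem hsmul hmem

/-- **All irreducible representations of an Azumaya algebra of constant rank `n²` have
dimension `n`.**
Let `k` be an algebraically closed field and `R` a `k`-algebra whose center `Z(R)` is an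
affine `k`-algebra.  Assume `R` is Azumaya over `Z(R)` and that for some `n ≥ 1` every
quotient `R/mR`, for `m` a maximal ideal of `Z(R)`, has `k`-dimension `n²`.  Then every
finite-dimensional irreducible representation `ρ : R → M_d(k)` satisfies `d = n`. -/
theorem azumaya_irrep_dimension
    (k R : Type*) [Field k] [IsAlgClosed k] [Ring R] [Algebra k R]
    (haffine : Algebra.FiniteType k (Subalgebra.center k R))
    (hfaithful : FaithfulSMul (Subalgebra.center k R) R)
    (hfg : Module.Finite (Subalgebra.center k R) R)
    (hproj : Module.Projective (Subalgebra.center k R) R)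
    (hbij : Function.Bijective (azumayaMulLeftRight (Subalgebra.center k R) R))
    (n : ℕ) (hn : 1 ≤ n)
    (hrank : ∀ m : Ideal (Subalgebra.center k R), m.IsMaximal →
      Module.finrank k
        (R ⧸ Ideal.map (algebraMap (Subalgebra.center k R) R) m) = n ^ 2)
    (d : ℕ) (hd : 1 ≤ d)
    (ρ : R →ₐ[k] Matrix (Fin d) (Fin d) k) (hsurj : Function.Surjective ρ) :
    d = n := by
  have : Nonempty (Fin d) := ⟨⟨0, hd⟩⟩
  have h := hrank _ (ker_comp_center_isMaximal ρ hsurj)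
  rw [← ker_eq_map_comap_of_azumayaMulLeftRight_surjective hbij.2] at h
  have e : (R ⧸ RingHom.ker (ρ : R →+* Matrix (Fin d) (Fin d) k)) ≃ₗ[k]
      Matrix (Fin d) (Fin d) k :=
    (Submodule.Quotient.restrictScalarsEquiv k _).symm ≪≫ₗ
      Submodule.quotEquivOfEq _ (LinearMap.ker ρ.toLinearMap) (by ext; rfl) ≪≫ₗ
      ρ.toLinearMap.quotKerEquivOfSurjective hsurj
  rw [e.finrank_eq, Module.finrank_matrix] at h
  simp only [Fintype.card_fin, Module.finrank_self, mul_one, ← pow_two] at h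
  exact Nat.pow_left_injective two_ne_zero h
end
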